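/- Let Z be a set of s ≥ 3 points in the complex projective plane ℙ² such that some line contains exactly s − 1 of the points (so exactly one point of Z lies off that line), and let I be its radical homogeneous ideal. Then α̂(I) = 2 − 1/(s − 1). -/

import Mathlib

open scoped LinearAlgebra.Projectivization

/-- A polynomial `F` vanishes to order at least `m` at the (affine representative) point
`v`: all iterated partial derivatives of order `≤ m - 1` (i.e. of order `< m`) vanish at `v`. -/
def VanishesToOrder (m : ℕ) (F : MvPolynomial (Fin 3) ℂ) (v : Fin 3 → ℂ) : Prop :=
  ∀ k : ℕ, k < m → ∀ d : Fin k → Fin 3,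
    MvPolynomial.eval v ((List.ofFn d).foldl (fun p i => MvPolynomial.pderiv i p) F) = 0

/-- The `m`-th symbolic power of the (radical) ideal of a set `Z` of points of `ℙ²`:
all polynomials vanishing to order at least `m` at every point of `Z`. -/
def symbolicPower (Z : Set (ℙ ℂ (Fin 3 → ℂ))) (m : ℕ) : Set (MvPolynomial (Fin 3) ℂ) :=
  {F | ∀ P ∈ Z, ∀ (v : Fin 3 → ℂ) (hv : v ≠ 0),
    Projectivization.mk ℂ v hv = P → VanishesToOrder m F v}

/-- The initial degree `α` of a set of polynomials: the least `t` such that the set contains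
a nonzero homogeneous polynomial of degree `t`. -/
noncomputable def initialDegree (S : Set (MvPolynomial (Fin 3) ℂ)) : ℕ :=
  sInf {t | ∃ F ∈ S, F ≠ 0 ∧ F.IsHomogeneous t}

/-- The Waldschmidt constant `α̂(I) = inf_{m ≥ 1} α(I^(m))/m` of the radical ideal of `Z`. -/
noncomputable def waldschmidt (Z : Set (ℙ ℂ (Fin 3 → ℂ))) : ℝ :=
  ⨅ m : ℕ+, (initialDegree (symbolicPower Z (m : ℕ)) : ℝ) / ((m : ℕ) : ℝ)

/-- A (homogeneous equation of a) line in `ℙ²`: a nonzero homogeneous polynomial of degree 1. -/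
def IsLine (L : MvPolynomial (Fin 3) ℂ) : Prop := L ≠ 0 ∧ L.IsHomogeneous 1

/-- The point `x ∈ ℙ²` lies on the line (or curve) with equation `L`. -/
def MemLine (L : MvPolynomial (Fin 3) ℂ) (x : ℙ ℂ (Fin 3 → ℂ)) : Prop :=
  ∀ (v : Fin 3 → ℂ) (hv : v ≠ 0), Projectivization.mk ℂ v hv = x → MvPolynomial.eval v L = 0

/-- Three points of `ℙ²` are collinear if some line contains all of them. -/
def Collin (x y z : ℙ ℂ (Fin 3 → ℂ)) : Prop :=
  ∃ M, IsLine M ∧ MemLine M x ∧ MemLine M y ∧ MemLine M z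

/-- `Z` is contained in a conic: the zero set of a nonzero homogeneous polynomial of degree 2
(possibly degenerate). -/
def ContainedInConic (Z : Set (ℙ ℂ (Fin 3 → ℂ))) : Prop :=
  ∃ F : MvPolynomial (Fin 3) ℂ, F ≠ 0 ∧ F.IsHomogeneous 2 ∧ ∀ x ∈ Z, MemLine F x

/-- The derivative of `F` in the direction `w`. -/
noncomputable def dirDeriv (w : Fin 3 → ℂ) (F : MvPolynomial (Fin 3) ℂ) :
    MvPolynomial (Fin 3) ℂ :=
  ∑ i, MvPolynomial.C (w i) * MvPolynomial.pderiv i F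

/-- The restriction of `F` to the parametrized affine line `t ↦ u + t w`. -/
noncomputable def restrictLine (u w : Fin 3 → ℂ) (F : MvPolynomial (Fin 3) ℂ) : Polynomial ℂ :=
  MvPolynomial.aeval (fun i => Polynomial.C (u i) + Polynomial.C (w i) * Polynomial.X) F

section VanishingOrder

open MvPolynomial

variable {m n : ℕ} {F G : MvPolynomial (Fin 3) ℂ} {v w : Fin 3 → ℂ}

lemma vanishesToOrder_zero : VanishesToOrder 0 F v := fun k hk => absurd hk k.not_lt_zero

lemma vanishesToOrder_succ :
    VanishesToOrder (m + 1) F v ↔ eval v F = 0 ∧ ∀ i, VanishesToOrder m (pderiv i F) v := by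
  constructor
  · intro h
    refine ⟨by simpa using h 0 (by omega) Fin.elim0, fun i k hk d => ?_⟩
    simpa [List.ofFn_succ] using h (k + 1) (by omega) (Fin.cons i d)
  · rintro ⟨h0, h⟩ k hk d
    cases k with
    | zero => simpa using h0
    | succ k => simpa [List.ofFn_succ] using h (d 0) k (by omega) (fun j => d j.succ)

lemma vanishesToOrder_one : VanishesToOrder 1 F v ↔ eval v F = 0 := by
  simp [vanishesToOrder_succ, vanishesToOrder_zero]

lemma VanishesToOrder.mono (h : VanishesToOrder n F v) (hmn : m ≤ n) : VanishesToOrder m F v :=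
  fun k hk => h k (hk.trans_le hmn)

lemma VanishesToOrder.add (hF : VanishesToOrder m F v) (hG : VanishesToOrder m G v) :
    VanishesToOrder m (F + G) v := by
  induction m generalizing F G with
  | zero => exact vanishesToOrder_zero
  | succ m ih =>
    rw [vanishesToOrder_succ] at hF hG ⊢
    refine ⟨by simp [hF.1, hG.1], fun i => ?_⟩
    rw [map_add]
    exact ih (hF.2 i) (hG.2 i)

lemma VanishesToOrder.mul (hF : VanishesToOrder m F v) (hG : VanishesToOrder n G v) :
    VanishesToOrder (m + n) (F * G) v := by
  suffices ∀ N a b (F G : MvPolynomial (Fin 3) ℂ), N ≤ a + b → VanishesToOrder a F v →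
      VanishesToOrder b G v → VanishesToOrder N (F * G) v from this _ _ _ _ _ le_rfl hF hG
  intro N
  induction N with
  | zero => intros; exact vanishesToOrder_zero
  | succ N ih =>
    intro a b F G hab hF hG
    refine vanishesToOrder_succ.2 ⟨?_, fun i => ?_⟩
    · cases a with
      | succ a => simp [(vanishesToOrder_succ.1 hF).1]
      | zero =>
        obtain ⟨b, rfl⟩ : ∃ c, b = c + 1 := ⟨b - 1, by omega⟩
        simp [(vanishesToOrder_succ.1 hG).1]
    · rw [pderiv_mul]
      apply VanishesToOrder.add
      · cases a with
        | succ a => exact ih a b _ _ (by omega) ((vanishesToOrder_succ.1 hF).2 i) hG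
        | zero => exact ih 0 b _ _ (by omega) vanishesToOrder_zero hG
      · cases b with
        | succ b => exact ih a b _ _ (by omega) hF ((vanishesToOrder_succ.1 hG).2 i)
        | zero => exact ih a 0 _ _ (by omega) hF vanishesToOrder_zero

lemma VanishesToOrder.pow (hF : VanishesToOrder m F v) (k : ℕ) :
    VanishesToOrder (k * m) (F ^ k) v := by
  induction k with
  | zero => simpa using vanishesToOrder_zero
  | succ k ih => simpa [pow_succ, add_mul] using ih.mul hF

lemma VanishesToOrder.prod {ι : Type*} (s : Finset ι) (f : ι → MvPolynomial (Fin 3) ℂ)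
    (a : ι → ℕ) (h : ∀ i ∈ s, VanishesToOrder (a i) (f i) v) :
    VanishesToOrder (∑ i ∈ s, a i) (∏ i ∈ s, f i) v := by
  classical
  induction s using Finset.induction_on with
  | empty => simpa using vanishesToOrder_zero
  | insert i s hi ih =>
    rw [Finset.sum_insert hi, Finset.prod_insert hi]
    exact (h i (by simp)).mul (ih fun j hj => h j (by simp [hj]))

lemma VanishesToOrder.C_mul (hF : VanishesToOrder m F v) (c : ℂ) :
    VanishesToOrder m (C c * F) v := by
  simpa using (vanishesToOrder_zero (F := C c)).mul hF

lemma VanishesToOrder.sum {ι : Type*} (s : Finset ι) (f : ι → MvPolynomial (Fin 3) ℂ)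
    (h : ∀ i ∈ s, VanishesToOrder m (f i) v) : VanishesToOrder m (∑ i ∈ s, f i) v := by
  refine Finset.sum_induction f (VanishesToOrder m · v) (fun _ _ => VanishesToOrder.add) ?_ h
  exact fun k _ d => by
    rw [List.foldl_fixed' (by simp), map_zero]

lemma VanishesToOrder.dirDeriv (hF : VanishesToOrder m F v) :
    VanishesToOrder (m - 1) (dirDeriv w F) v := by
  cases m with
  | zero => exact vanishesToOrder_zero
  | succ m => exact .sum _ _ fun i _ => ((vanishesToOrder_succ.1 hF).2 i).C_mul _

lemma VanishesToOrder.iterate_dirDeriv (hF : VanishesToOrder m F v) (k : ℕ) :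
    VanishesToOrder (m - k) ((_root_.dirDeriv w)^[k] F) v := by
  induction k with
  | zero => simpa using hF
  | succ k ih => simpa only [Function.iterate_succ_apply', Nat.sub_sub] using ih.dirDeriv

lemma pderiv_pderiv_comm (i j : Fin 3) (F : MvPolynomial (Fin 3) ℂ) :
    pderiv i (pderiv j F) = pderiv j (pderiv i F) := by
  have h : ⁅pderiv (R := ℂ) i, pderiv (R := ℂ) j⁆ = 0 := by
    ext k
    simp [Derivation.commutator_apply, Pi.single_apply, apply_ite]
  simpa [Derivation.commutator_apply, sub_eq_zero] using congrArg (· F) h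

lemma pderiv_dirDeriv (i : Fin 3) : pderiv i (dirDeriv w F) = dirDeriv w (pderiv i F) := by
  simp [dirDeriv, pderiv_pderiv_comm i]

lemma MvPolynomial.IsHomogeneous.dirDeriv {d : ℕ} (hF : F.IsHomogeneous d) :
    (dirDeriv w F).IsHomogeneous (d - 1) :=
  .sum _ _ _ fun i _ => by simpa using (isHomogeneous_C _ (w i)).mul (hF.pderiv (i := i))

lemma MvPolynomial.IsHomogeneous.iterate_dirDeriv {d : ℕ} (hF : F.IsHomogeneous d) (k : ℕ) :
    ((_root_.dirDeriv w)^[k] F).IsHomogeneous (d - k) := by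
  induction k with
  | zero => simpa using hF
  | succ k ih => simpa only [Function.iterate_succ_apply', Nat.sub_sub] using ih.dirDeriv

lemma MvPolynomial.IsHomogeneous.dirDeriv_of_degree_zero (hF : F.IsHomogeneous 0) :
    _root_.dirDeriv w F = 0 := by
  rw [← totalDegree_zero_iff_isHomogeneous, totalDegree_eq_zero_iff_eq_C] at hF
  rw [hF]
  simp [_root_.dirDeriv]

lemma eval_dirDeriv_self {d : ℕ} (hF : F.IsHomogeneous d) :
    eval v (dirDeriv v F) = d * eval v F := by
  simpa [dirDeriv] using congrArg (eval v) hF.sum_X_mul_pderiv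

/-- Differentiating a form in the direction of a point keeps its order of vanishing there. -/
lemma VanishesToOrder.dirDeriv_self {d : ℕ} (hd : F.IsHomogeneous d)
    (hF : VanishesToOrder m F v) : VanishesToOrder m (_root_.dirDeriv v F) v := by
  induction m generalizing F d with
  | zero => exact vanishesToOrder_zero
  | succ m ih =>
    rw [vanishesToOrder_succ] at hF ⊢
    refine ⟨by simp [eval_dirDeriv_self hd, hF.1], fun i => ?_⟩
    rw [pderiv_dirDeriv]
    exact ih hd.pderiv (hF.2 i)

lemma VanishesToOrder.le_degree {d : ℕ} (hF : VanishesToOrder m F v) (hd : F.IsHomogeneous d)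
    (h0 : F ≠ 0) : m ≤ d := by
  induction d generalizing F m with
  | zero =>
    by_contra! hm
    have h := vanishesToOrder_one.1 (hF.mono hm)
    rw [← totalDegree_zero_iff_isHomogeneous, totalDegree_eq_zero_iff_eq_C] at hd
    rw [hd, eval_C] at h
    exact h0 (by rw [hd, h, C_0])
  | succ d ih =>
    cases m with
    | zero => exact Nat.zero_le _
    | succ m =>
      obtain ⟨i, hi⟩ : ∃ i, pderiv i F ≠ 0 := by
        by_contra! h
        have := hd.sum_X_mul_pderiv
        simp only [h, mul_zero, Finset.sum_const_zero] at this
        exact smul_ne_zero d.succ_ne_zero h0 this.symm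
      exact Nat.succ_le_succ (ih ((vanishesToOrder_succ.1 hF).2 i) hd.pderiv hi)

lemma VanishesToOrder.add_le_degree {d k : ℕ} (hF : VanishesToOrder m F v)
    (hd : F.IsHomogeneous d) (h0 : (_root_.dirDeriv v)^[k] F ≠ 0) : m + k ≤ d := by
  induction k generalizing F d with
  | zero => exact hF.le_degree hd h0
  | succ k ih =>
    have h1 := ih (hF.dirDeriv_self hd) hd.dirDeriv h0
    cases d with
    | succ d => omega
    | zero =>
      have h2 : ∀ j, (_root_.dirDeriv v)^[j] (0 : MvPolynomial (Fin 3) ℂ) = 0 := fun j =>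
        Function.iterate_fixed (by simp [_root_.dirDeriv]) j
      rw [Function.iterate_succ_apply, hd.dirDeriv_of_degree_zero, h2] at h0
      exact absurd rfl h0

end VanishingOrder

section RestrictLine

open MvPolynomial

variable {F : MvPolynomial (Fin 3) ℂ} {u w : Fin 3 → ℂ}

lemma eval_restrictLine (a : ℂ) : (restrictLine u w F).eval a = eval (u + a • w) F := by
  rw [restrictLine]
  induction F using MvPolynomial.induction_on with
  | C a => simp
  | add p q hp hq => simp [hp, hq]
  | mul_X p j h => simp [h, mul_comm a]

lemma derivative_restrictLine :
    Polynomial.derivative (restrictLine u w F) = restrictLine u w (dirDeriv w F) := by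
  simp only [restrictLine, dirDeriv]
  induction F using MvPolynomial.induction_on with
  | C a => simp
  | add p q hp hq => simp [hp, hq, mul_add, Finset.sum_add_distrib]
  | mul_X p j h =>
    have hX : ∑ i, C (w i) * (p * pderiv i (X j)) = C (w j) * p := by
      simp [Pi.single_apply]
    simp only [pderiv_mul, mul_add, Finset.sum_add_distrib, hX]
    simp only [← mul_assoc, ← Finset.sum_mul]
    rw [map_mul, Polynomial.derivative_mul, h, map_add, map_mul, map_mul,
      aeval_X, aeval_C, Polynomial.algebraMap_eq, Polynomial.derivative_add,
      Polynomial.derivative_C_mul, Polynomial.derivative_C, Polynomial.derivative_X]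
    ring

lemma iterate_derivative_restrictLine (k : ℕ) :
    Polynomial.derivative^[k] (restrictLine u w F) = restrictLine u w ((dirDeriv w)^[k] F) := by
  induction k with
  | zero => rfl
  | succ k ih => rw [Function.iterate_succ_apply', ih, derivative_restrictLine,
      Function.iterate_succ_apply']

lemma natDegree_restrictLine_le {d : ℕ} (hF : F.IsHomogeneous d) :
    (restrictLine u w F).natDegree ≤ d := by
  simpa [restrictLine] using MvPolynomial.aeval_natDegree_le F hF.totalDegree_le _
    (n := 1) fun i => (by compute_degree)

lemma VanishesToOrder.le_rootMultiplicity {m : ℕ} {a : ℂ} (hF : VanishesToOrder m F (u + a • w))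
    (h0 : restrictLine u w F ≠ 0) : m ≤ (restrictLine u w F).rootMultiplicity a := by
  cases m with
  | zero => exact Nat.zero_le _
  | succ m =>
    refine Polynomial.lt_rootMultiplicity_of_isRoot_iterate_derivative h0 fun k hk => ?_
    rw [iterate_derivative_restrictLine, Polynomial.IsRoot, eval_restrictLine]
    exact vanishesToOrder_one.1 ((hF.iterate_dirDeriv k).mono (by omega))

/-- Bézout's bound for a form restricted to a line. -/
lemma card_mul_le_degree {m d : ℕ} (hd : F.IsHomogeneous d) (h0 : restrictLine u w F ≠ 0)
    (s : Finset ℂ) (hs : ∀ a ∈ s, VanishesToOrder m F (u + a • w)) : s.card * m ≤ d := by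
  classical
  calc s.card * m = ∑ _a ∈ s, m := by simp
    _ ≤ ∑ a ∈ s, (restrictLine u w F).roots.count a :=
      Finset.sum_le_sum fun a ha => by
        rw [Polynomial.count_roots]; exact (hs a ha).le_rootMultiplicity h0
    _ ≤ (restrictLine u w F).roots.card := by
      rw [← Multiset.sum_count_eq_card (s := s ∪ (restrictLine u w F).roots.toFinset)
        (fun a ha => by simp [Multiset.mem_toFinset.2 ha])]
      exact Finset.sum_le_sum_of_subset Finset.subset_union_left
    _ ≤ d := (Polynomial.card_roots' _).trans (natDegree_restrictLine_le hd)

lemma eval_smul_of_isHomogeneous {d : ℕ} (hd : F.IsHomogeneous d) (c : ℂ) (v : Fin 3 → ℂ) :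
    eval (c • v) F = c ^ d * eval v F := by
  rw [eval_eq', eval_eq', Finset.mul_sum]
  refine Finset.sum_congr rfl fun e he => ?_
  have h : ∑ i, e i = d := by
    rw [← hd (mem_support_iff.1 he), Finsupp.weight_apply, Finsupp.sum_fintype _ _ (by simp)]
    simp
  simp only [Pi.smul_apply, smul_eq_mul, mul_pow, Finset.prod_mul_distrib,
    Finset.prod_pow_eq_pow_sum, h]
  ring

lemma restrictLine_ne_zero {d : ℕ} (hd : F.IsHomogeneous d) (hw : eval w F ≠ 0) :
    restrictLine u w F ≠ 0 := by
  intro h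
  have h1 : restrictLine w u F = 0 := by
    refine Polynomial.eq_zero_of_infinite_isRoot _ (Set.Infinite.mono (s := {0}ᶜ) ?_
      (Set.finite_singleton _).infinite_compl)
    intro a (ha : a ≠ 0)
    have h2 : w + a • u = a • (u + a⁻¹ • w) := by simp [smul_add, smul_smul, ha, add_comm]
    change Polynomial.eval _ _ = 0
    rw [eval_restrictLine, h2, eval_smul_of_isHomogeneous hd, ← eval_restrictLine, h]
    simp
  apply hw
  simpa [h1] using (eval_restrictLine (F := F) (u := w) (w := u) 0).symm

end RestrictLine

section Lines

open MvPolynomial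

lemma eval_linear {L : MvPolynomial (Fin 3) ℂ} (hL : L.IsHomogeneous 1) :
    ∃ l : Fin 3 → ℂ, ∀ v, eval v L = v ⬝ᵥ l := by
  have h (i : Fin 3) : pderiv i L = C (coeff 0 (pderiv i L)) := by
    rw [← totalDegree_eq_zero_iff_eq_C, totalDegree_zero_iff_isHomogeneous]
    exact hL.pderiv
  refine ⟨fun i => coeff 0 (pderiv i L), fun v => ?_⟩
  have h1 := hL.sum_X_mul_pderiv
  rw [one_smul] at h1
  conv_lhs => rw [← h1, map_sum]
  refine Finset.sum_congr rfl fun i _ => ?_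
  rw [map_mul, eval_X, h i, eval_C]

/-- Any two points lie on a common line. -/
lemma exists_isLine_of_two_points (v w : Fin 3 → ℂ) :
    ∃ M, IsLine M ∧ eval v M = 0 ∧ eval w M = 0 := by
  have hker : LinearMap.ker (Matrix.mulVecLin !![v 0, v 1, v 2; w 0, w 1, w 2]) ≠ ⊥ :=
    LinearMap.ker_ne_bot_of_finrank_lt (by simp)
  obtain ⟨l, hl, hl0⟩ := (Submodule.ne_bot_iff _).1 hker
  have hl1 := congrFun hl 0
  have hl2 := congrFun hl 1
  simp [Matrix.mulVec, dotProduct, Fin.sum_univ_three] at hl1 hl2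
  refine ⟨∑ i, C (l i) * X i, ⟨fun h => hl0 ?_, ?_⟩, ?_, ?_⟩
  · ext i
    simpa [Pi.single_apply] using congrArg (eval (Pi.single i 1)) h
  · exact .sum _ _ _ fun i _ => by simpa using (isHomogeneous_C _ (l i)).mul (isHomogeneous_X _ i)
  · simpa [Fin.sum_univ_three, mul_comm] using hl1
  · simpa [Fin.sum_univ_three, mul_comm] using hl2

/-- If `u`, `x`, `p` lie on a line and `x` is a multiple of neither `u` nor `p`, then `p` is
projectively of the form `u + c x`. -/
lemma exists_mk_add_smul_eq {l u x : Fin 3 → ℂ} (hl : l ≠ 0) (hu : u ⬝ᵥ l = 0)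
    (hx : x ⬝ᵥ l = 0) (hu0 : u ≠ 0) (hxu : ∀ c : ℂ, x ≠ c • u) {P : ℙ ℂ (Fin 3 → ℂ)}
    (hP : P.rep ⬝ᵥ l = 0) (hxP : ∀ c : ℂ, x ≠ c • P.rep) :
    ∃ (c : ℂ) (h : u + c • x ≠ 0), Projectivization.mk ℂ (u + c • x) h = P := by
  obtain ⟨a, ha0, ha⟩ : ∃ a : Fin 3 → ℂ, a ≠ 0 ∧ a 0 • u + a 1 • x + a 2 • P.rep = 0 := by
    have hdet : (Matrix.of ![u, x, P.rep]).det = 0 :=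
      Matrix.exists_mulVec_eq_zero_iff.1 ⟨l, hl, by
        ext i; fin_cases i <;> simpa [Matrix.mulVec] using by assumption⟩
    obtain ⟨a, ha0, ha⟩ := Matrix.exists_vecMul_eq_zero_iff.2 hdet
    refine ⟨a, ha0, ?_⟩
    ext i
    simpa [Matrix.vecMul, dotProduct, Fin.sum_univ_three] using congrFun ha i
  have key : ∀ (r s : ℂ) (y : Fin 3 → ℂ), y ≠ 0 → (∀ c : ℂ, x ≠ c • y) →
      r • y + s • x = 0 → r = 0 ∧ s = 0 := by
    intro r s y hy hxy h
    have hs : s = 0 := by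
      by_contra hs
      refine hxy (-(s⁻¹ * r)) ?_
      rw [neg_smul, mul_smul, ← smul_neg, ← eq_neg_of_add_eq_zero_right h, smul_smul,
        inv_mul_cancel₀ hs, one_smul]
    subst hs
    simpa [hy] using h
  have h0 : a 0 ≠ 0 := by
    intro h
    obtain ⟨h2, h1⟩ := key (a 2) (a 1) _ P.rep_nonzero hxP (by simpa [h, add_comm] using ha)
    exact ha0 (by ext i; fin_cases i <;> simpa)
  have h2 : a 2 ≠ 0 := by
    intro h
    obtain ⟨h0', h1⟩ := key (a 0) (a 1) _ hu0 hxu (by simpa [h] using ha)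
    exact h0 h0'
  have heq : u + (a 1 / a 0) • x = (-(a 2 / a 0)) • P.rep := by
    rw [neg_smul, ← add_eq_zero_iff_eq_neg]
    have := congrArg ((a 0)⁻¹ • ·) ha
    simpa [smul_add, smul_smul, h0, div_eq_inv_mul] using this
  have hc : -(a 2 / a 0) ≠ 0 := neg_ne_zero.2 (div_ne_zero h2 h0)
  have hv : u + (a 1 / a 0) • x ≠ 0 := heq ▸ smul_ne_zero hc P.rep_nonzero
  refine ⟨_, hv, ?_⟩
  conv_rhs => rw [← P.mk_rep]
  rw [Projectivization.mk_eq_mk_iff']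
  exact ⟨_, heq.symm⟩

end Lines

section Bounds

open MvPolynomial

variable {F : MvPolynomial (Fin 3) ℂ} {q l : Fin 3 → ℂ}

/-- Some derivative of a nonzero polynomial `F` in a direction transverse to a plane does not
vanish identically on that plane. -/
lemma exists_iterate_dirDeriv_ne_zero (hq : q ⬝ᵥ l ≠ 0) (hF : F ≠ 0) :
    ∃ k x, x ⬝ᵥ l = 0 ∧ eval x ((dirDeriv q)^[k] F) ≠ 0 := by
  by_contra! h
  refine hF (MvPolynomial.funext fun y => ?_)
  set c := (y ⬝ᵥ l) / (q ⬝ᵥ l) with hc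
  set x := y - c • q with hx
  have hxl : x ⬝ᵥ l = 0 := by simp [hx, hc, sub_dotProduct, hq]
  have hr : restrictLine x q F = 0 := by
    by_contra h0
    refine lt_irrefl _ (Polynomial.lt_rootMultiplicity_of_isRoot_iterate_derivative (t := 0) h0
      fun k _ => ?_)
    rw [iterate_derivative_restrictLine, Polynomial.IsRoot, eval_restrictLine]
    simpa using h k x hxl
  have heval := eval_restrictLine (u := x) (w := q) (F := F) c
  rw [hr, hx, sub_add_cancel] at heval
  simpa using heval.symm

lemma mul_le_mul_degree {T : Finset (ℙ ℂ (Fin 3 → ℂ))} {m d : ℕ} (hT : T.Nonempty)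
    (hTl : ∀ P ∈ T, P.rep ⬝ᵥ l = 0) (hq : q ⬝ᵥ l ≠ 0) (hF : F ≠ 0) (hd : F.IsHomogeneous d)
    (hFq : VanishesToOrder m F q) (hFT : F ∈ symbolicPower T m) :
    (2 * T.card - 1) * m ≤ T.card * d := by
  classical
  obtain ⟨k, x, hxl, hx⟩ := exists_iterate_dirDeriv_ne_zero hq hF
  have hmk : m + k ≤ d := hFq.add_le_degree hd (by rintro h; simp [h] at hx)
  obtain ⟨n, hn⟩ : ∃ n, T.card = n + 1 := ⟨T.card - 1, by have := hT.card_pos; omega⟩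
  rcases le_or_gt m k with hle | hlt
  · rw [hn, show 2 * (n + 1) - 1 = 2 * n + 1 by omega]
    nlinarith
  set G := (dirDeriv q)^[k] F
  have hG : G.IsHomogeneous (d - k) := hd.iterate_dirDeriv k
  have hGT (P) (hP : P ∈ T) (v) (hv : v ≠ 0) (hvP : Projectivization.mk ℂ v hv = P) :
      VanishesToOrder (m - k) G v := (hFT P hP v hv hvP).iterate_dirDeriv k
  have hxT (P) (hP : P ∈ T) (c : ℂ) : x ≠ c • P.rep := by
    rintro rfl
    rw [eval_smul_of_isHomogeneous hG, vanishesToOrder_one.1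
      ((hGT P hP _ P.rep_nonzero P.mk_rep).mono (by omega)), mul_zero] at hx
    exact hx rfl
  obtain ⟨U, hU⟩ := hT
  have hl : l ≠ 0 := by rintro rfl; simp at hq
  have hc (P : T) := exists_mk_add_smul_eq hl (hTl U hU) hxl U.rep_nonzero (hxT U hU)
    (hTl P P.2) (hxT P P.2)
  choose c hc0 hc using hc
  have hinj : Function.Injective c := by
    intro P P' h
    apply Subtype.ext
    rw [← hc P, ← hc P']
    simp only [h]
  have hB := card_mul_le_degree (m := m - k) (u := U.rep) hG (restrictLine_ne_zero hG hx)
    (Finset.univ.image c) (by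
      intro a ha
      obtain ⟨P, -, rfl⟩ := Finset.mem_image.1 ha
      exact hGT P P.2 _ (hc0 P) (hc P))
  rw [Finset.card_image_of_injective _ hinj, Finset.card_univ, Fintype.card_coe, hn] at hB
  obtain ⟨r, rfl⟩ := Nat.exists_eq_add_of_lt hlt
  obtain ⟨e, rfl⟩ := Nat.exists_eq_add_of_le hmk
  rw [hn, show 2 * (n + 1) - 1 = 2 * n + 1 by omega]
  rw [show k + r + 1 - k = r + 1 by omega, show k + r + 1 + k + e - k = k + r + 1 + e by omega]
    at hB
  nlinarith

lemma exists_mem_symbolicPower (T : Finset (ℙ ℂ (Fin 3 → ℂ))) (hT : T.Nonempty)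
    (Q : ℙ ℂ (Fin 3 → ℂ)) {L : MvPolynomial (Fin 3) ℂ} (hL : IsLine L)
    (hTL : ∀ P ∈ T, MemLine L P) :
    ∃ H ∈ symbolicPower (insert Q (T : Set (ℙ ℂ (Fin 3 → ℂ)))) T.card,
      H ≠ 0 ∧ H.IsHomogeneous (2 * T.card - 1) := by
  classical
  choose M hM hMP hMQ using fun P : ℙ ℂ (Fin 3 → ℂ) => exists_isLine_of_two_points P.rep Q.rep
  have hcard := hT.card_pos
  have hvan {N : MvPolynomial (Fin 3) ℂ} (hN : IsLine N) (P : ℙ ℂ (Fin 3 → ℂ))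
      (hNP : eval P.rep N = 0) (v : Fin 3 → ℂ) (hv : v ≠ 0)
      (hvP : Projectivization.mk ℂ v hv = P) : VanishesToOrder 1 N v := by
    rw [← P.mk_rep, Projectivization.mk_eq_mk_iff'] at hvP
    obtain ⟨c, rfl⟩ := hvP
    rw [vanishesToOrder_one, eval_smul_of_isHomogeneous hN.2, hNP, mul_zero]
  refine ⟨L ^ (T.card - 1) * ∏ P ∈ T, M P, ?_, ?_, ?_⟩
  · rintro P (rfl | hP) v hv hvP
    · have h := VanishesToOrder.prod (v := v) T M (fun _ => 1)
        fun R _ => hvan (hM R) P (hMQ R) v hv hvP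
      simpa using (vanishesToOrder_zero (F := L ^ (T.card - 1))).mul h
    · have hP' : P ∈ T := hP
      have h := VanishesToOrder.prod (v := v) T M (fun R => if R = P then 1 else 0) fun R _ => by
        split_ifs with hR
        · subst hR
          exact hvan (hM R) R (hMP R) v hv hvP
        · exact vanishesToOrder_zero
      have h2 := (((vanishesToOrder_one (F := L)).2 (hTL P hP' v hv hvP)).pow (T.card - 1)).mul h
      refine h2.mono ?_
      simp [hP']
      omega
  · exact mul_ne_zero (pow_ne_zero _ hL.1) (Finset.prod_ne_zero_iff.2 fun P _ => (hM P).1)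
  · have h := (hL.2.pow (T.card - 1)).mul (IsHomogeneous.prod T M (fun _ => 1) fun P _ => (hM P).2)
    convert h using 1
    simp
    omega

end Bounds

/-- If `Z` is a set of `s ≥ 3` points of `ℙ²` such that some line contains exactly `s - 1` of
the points, then the Waldschmidt constant of its radical ideal is `2 - 1/(s-1)`. -/
theorem waldschmidt_all_but_one_collinear (Z : Set (ℙ ℂ (Fin 3 → ℂ)))
    (hfin : Z.Finite) (hcard : 3 ≤ Z.ncard)
    (hline : ∃ L : MvPolynomial (Fin 3) ℂ, IsLine L ∧
      (Z ∩ {x | MemLine L x}).ncard = Z.ncard - 1) :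
    waldschmidt Z = 2 - 1 / ((Z.ncard : ℝ) - 1) := by
  classical
  obtain ⟨L, hL, hLcard⟩ := hline
  obtain ⟨T, hT⟩ := (hfin.inter_of_left {x | MemLine L x}).exists_finset_coe
  have hTcard : T.card = Z.ncard - 1 := by rw [← hLcard, ← hT, Set.ncard_coe_finset]
  have hTne : T.Nonempty := Finset.card_pos.1 (by omega)
  obtain ⟨Q, hQZ, hQL⟩ : ∃ Q ∈ Z, ¬ MemLine L Q := by
    by_contra! h
    rw [Set.inter_eq_left.2 (show Z ⊆ {x | MemLine L x} from h)] at hLcard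
    omega
  have hmem (P) : P ∈ T ↔ P ∈ Z ∧ MemLine L P := by
    rw [← Finset.mem_coe, hT]; rfl
  have hQT : Q ∉ T := fun h => hQL ((hmem Q).1 h).2
  have hZ : insert Q (T : Set (ℙ ℂ (Fin 3 → ℂ))) = Z := by
    refine Set.eq_of_subset_of_ncard_le ?_ ?_ hfin
    · exact Set.insert_subset hQZ fun P hP => ((hmem P).1 hP).1
    · rw [Set.ncard_insert_of_notMem (by simpa using hQT), Set.ncard_coe_finset]
      omega
  obtain ⟨l, hl⟩ := eval_linear hL.2
  obtain ⟨q, hq0, hqQ, hq⟩ : ∃ (q : Fin 3 → ℂ) (hq : q ≠ 0), Projectivization.mk ℂ q hq = Q ∧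
      MvPolynomial.eval q L ≠ 0 := by
    simpa [MemLine] using hQL
  obtain ⟨H, hHZ, hH0, hHd⟩ := exists_mem_symbolicPower T hTne Q hL fun P hP => ((hmem P).1 hP).2
  rw [hZ] at hHZ
  have hTpos : (0 : ℝ) < T.card := by exact_mod_cast hTne.card_pos
  have hval : 2 - 1 / ((Z.ncard : ℝ) - 1) = ((2 * T.card - 1 : ℕ) : ℝ) / T.card := by
    have h1 : (Z.ncard : ℝ) - 1 = T.card := by
      rw [hTcard, Nat.cast_sub (by omega), Nat.cast_one]
    rw [h1, Nat.cast_sub (by omega)]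
    push_cast
    rw [eq_div_iff hTpos.ne', sub_mul, one_div, inv_mul_cancel₀ hTpos.ne']
  rw [hval]
  apply le_antisymm
  · refine (ciInf_le ⟨0, ?_⟩ ⟨T.card, hTne.card_pos⟩).trans ?_
    · rintro _ ⟨m, rfl⟩
      positivity
    · exact div_le_div_of_nonneg_right (Nat.cast_le.2 (Nat.sInf_le ⟨H, hHZ, hH0, hHd⟩)) hTpos.le
  · refine le_ciInf fun m => ?_
    have hne : {t | ∃ F ∈ symbolicPower Z (m : ℕ), F ≠ 0 ∧ F.IsHomogeneous t}.Nonempty :=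
      ⟨_, H ^ (m : ℕ), fun P hP v hv hvP => ((hHZ P hP v hv hvP).pow m).mono
        (Nat.le_mul_of_pos_right _ hTne.card_pos), pow_ne_zero _ hH0, hHd.pow _⟩
    obtain ⟨F, hFZ, hF0, hFd⟩ := Nat.sInf_mem hne
    have hbound := mul_le_mul_degree hTne
      (fun P hP => by rw [← hl]; exact ((hmem P).1 hP).2 _ P.rep_nonzero P.mk_rep)
      (by rwa [← hl]) hF0 hFd (hFZ Q hQZ q hq0 hqQ)
      (fun P hP => hFZ P ((hmem P).1 hP).1)
    rw [div_le_div_iff₀ hTpos (by exact_mod_cast m.pos), mul_comm _ (T.card : ℝ)]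
    exact_mod_cast hbound
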